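/- Let (W,S) be a finitely generated Coxeter system with Cayley graph Λ(W,S), and let P be a Parallel Wall function for (W,S). Suppose α is a geodesic edge path in Λ connecting vertices a and b, v is a vertex of α, and both a and b are within distance A of Q̄ for some wall Q. Then v is within distance 2A(2P(1) + 1) + P(1) of Q̄. -/

import Mathlib

/-!
Common definitions: Cayley graph of a Coxeter system, walls, sides,
bracket numbers, edge paths, quasi-geodesics, tracking.
-/

namespace CoxTrack

variable {B : Type*} {W : Type*} [Group W] {M : CoxeterMatrix B}

/-- The word metric on the Cayley graph `Λ(W,S)`: `d u v = ℓ(u⁻¹ v)`. -/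
noncomputable def d (cs : CoxeterSystem M W) (u v : W) : ℕ := cs.length (u⁻¹ * v)

/-- `u` and `v` are adjacent vertices (endpoints of a common edge) of `Λ(W,S)`. -/
def Adj (cs : CoxeterSystem M W) (u v : W) : Prop := ∃ i : B, v = u * cs.simple i

/-- The edge with endpoints `u` and `v` belongs to the wall of the reflection `t`
(i.e. `t` fixes this edge setwise, interchanging its endpoints). -/
def EdgeInWall (cs : CoxeterSystem M W) (t u v : W) : Prop :=
  Adj cs u v ∧ t * u = v

/-- `v` is a vertex of `Q̄`, the union of the edges of the wall of the reflection `t`. -/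
def InWallBar (cs : CoxeterSystem M W) (t v : W) : Prop :=
  ∃ i : B, t * v = v * cs.simple i

/-- Vertices `u` and `v` lie on the same side of the wall of the reflection `t`. -/
def SameSide (cs : CoxeterSystem M W) (t u v : W) : Prop :=
  (cs.length (t * u) < cs.length u ↔ cs.length (t * v) < cs.length v)

/-- The wall of the reflection `t` separates the vertices `u` and `v`. -/
def SeparatesPts (cs : CoxeterSystem M W) (t u v : W) : Prop := ¬ SameSide cs t u v

/-- The walls of the reflections `t` and `t'` are parallel: they are distinct and
all edges of each one lie on one side of the other. -/
def Parallel (cs : CoxeterSystem M W) (t t' : W) : Prop :=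
  t ≠ t' ∧ (∀ u v, InWallBar cs t' u → InWallBar cs t' v → SameSide cs t u v)
         ∧ (∀ u v, InWallBar cs t u → InWallBar cs t v → SameSide cs t' u v)

/-- The walls of the reflections `t` and `t'` cross (they are distinct and not parallel). -/
def Crosses (cs : CoxeterSystem M W) (t t' : W) : Prop := t ≠ t' ∧ ¬ Parallel cs t t'

/-- The wall of the reflection `r` separates `Q̄` (for the wall of the reflection `t`)
from the vertex `p`. -/
def SepWallFromPt (cs : CoxeterSystem M W) (r t p : W) : Prop :=
  ∀ v, InWallBar cs t v → SeparatesPts cs r v p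

/-- The distance from the vertex `p` to `Q̄` (the wall of the reflection `t`),
measured to the nearest vertex of `Q̄`. -/
noncomputable def wallDist (cs : CoxeterSystem M W) (t p : W) : ℕ :=
  sInf {n : ℕ | ∃ v, InWallBar cs t v ∧ d cs p v = n}

/-- `v 0, v 1, …, v n` are the consecutive vertices of an edge path of length `n` in `Λ(W,S)`. -/
def IsPath (cs : CoxeterSystem M W) (v : ℕ → W) (n : ℕ) : Prop :=
  ∀ k, k < n → Adj cs (v k) (v (k+1))

/-- `v 0, …, v n` are the consecutive vertices of a geodesic edge path of length `n`. -/
def IsGeodesic (cs : CoxeterSystem M W) (v : ℕ → W) (n : ℕ) : Prop :=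
  IsPath cs v n ∧ d cs (v 0) (v n) = n

/-- `v 0, v 1, …` are the consecutive vertices of an edge path ray. -/
def IsRay (cs : CoxeterSystem M W) (v : ℕ → W) : Prop := ∀ k, Adj cs (v k) (v (k+1))

/-- A geodesic edge path ray. -/
def IsGeodesicRay (cs : CoxeterSystem M W) (v : ℕ → W) : Prop :=
  IsRay cs v ∧ ∀ j k, j ≤ k → d cs (v j) (v k) = k - j

/-- `…, v (-1), v 0, v 1, …` are the consecutive vertices of an edge path line. -/
def IsLine (cs : CoxeterSystem M W) (v : ℤ → W) : Prop := ∀ k : ℤ, Adj cs (v k) (v (k+1))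

/-- A geodesic edge path line. -/
def IsGeodesicLine (cs : CoxeterSystem M W) (v : ℤ → W) : Prop :=
  IsLine cs v ∧ ∀ j k : ℤ, j ≤ k → (d cs (v j) (v k) : ℤ) = k - j

/-- The set of (reflections of) walls bracketing the vertex `v k` of the edge path
`v 0, …, v n`: walls containing an edge of the path before `v k` and an edge after `v k`. -/
def Brackets (cs : CoxeterSystem M W) (v : ℕ → W) (n k : ℕ) : Set W :=
  {t | ∃ j m, j < k ∧ k ≤ m ∧ m < n ∧
      EdgeInWall cs t (v j) (v (j+1)) ∧ EdgeInWall cs t (v m) (v (m+1))}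

/-- The set of walls bracketing the vertex `v k` of the edge path ray `v`. -/
def BracketsRay (cs : CoxeterSystem M W) (v : ℕ → W) (k : ℕ) : Set W :=
  {t | ∃ j m, j < k ∧ k ≤ m ∧
      EdgeInWall cs t (v j) (v (j+1)) ∧ EdgeInWall cs t (v m) (v (m+1))}

/-- The set of walls bracketing the vertex `v k` of the edge path line `v`. -/
def BracketsLine (cs : CoxeterSystem M W) (v : ℤ → W) (k : ℤ) : Set W :=
  {t | ∃ j m : ℤ, j < k ∧ k ≤ m ∧
      EdgeInWall cs t (v j) (v (j+1)) ∧ EdgeInWall cs t (v m) (v (m+1))}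

/-- The edge path `v 0, …, v n` is a `(lam, eps)`-quasi-geodesic. -/
def IsQG (cs : CoxeterSystem M W) (lam eps : ℝ) (v : ℕ → W) (n : ℕ) : Prop :=
  IsPath cs v n ∧ ∀ j k, j ≤ n → k ≤ n →
    |(j : ℝ) - (k : ℝ)| ≤ lam * (d cs (v j) (v k) : ℝ) + eps

/-- The edge path ray `v` is a `(lam, eps)`-quasi-geodesic. -/
def IsQGRay (cs : CoxeterSystem M W) (lam eps : ℝ) (v : ℕ → W) : Prop :=
  IsRay cs v ∧ ∀ j k : ℕ, |(j : ℝ) - (k : ℝ)| ≤ lam * (d cs (v j) (v k) : ℝ) + eps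

/-- The edge path line `v` is a `(lam, eps)`-quasi-geodesic. -/
def IsQGLine (cs : CoxeterSystem M W) (lam eps : ℝ) (v : ℤ → W) : Prop :=
  IsLine cs v ∧ ∀ j k : ℤ, |(j : ℝ) - (k : ℝ)| ≤ lam * (d cs (v j) (v k) : ℝ) + eps

/-- `P` is a Parallel Wall function for `(W,S)`: for each positive integer `n`, every wall `Q`
and every vertex `p` at distance at least `P n` from `Q̄`, there are `n` distinct pairwise
parallel walls separating `Q̄` from `p`. -/
def IsParallelWallFn (cs : CoxeterSystem M W) (P : ℕ → ℕ) : Prop :=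
  ∀ n : ℕ, 0 < n → ∀ t p : W, cs.IsReflection t → P n ≤ wallDist cs t p →
    ∃ T : Finset W, T.card = n ∧ (∀ r ∈ T, cs.IsReflection r) ∧
      (∀ r ∈ T, ∀ r' ∈ T, r ≠ r' → Parallel cs r r') ∧
      (∀ r ∈ T, SepWallFromPt cs r t p)

/-- `w 0, …, w m` (with distinguished approximation vertices `w (c 0), …, w (c n)`)
is an `L`-approximation of the edge path `v 0, …, v n`: it is an edge path with the
same endpoints, the segment from `w (c i)` to `w (c (i+1))` is geodesic, and the
approximation vertex `w (c i)` is within `L` of `v i`. -/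
def IsApprox (cs : CoxeterSystem M W) (L : ℕ) (v : ℕ → W) (n : ℕ)
    (w : ℕ → W) (m : ℕ) (c : ℕ → ℕ) : Prop :=
  IsPath cs w m ∧ c 0 = 0 ∧ c n = m ∧ (∀ i, i < n → c i ≤ c (i+1)) ∧
  w 0 = v 0 ∧ w m = v n ∧
  (∀ i, i ≤ n → d cs (w (c i)) (v i) ≤ L) ∧
  (∀ i, i < n → d cs (w (c i)) (w (c (i+1))) = c (i+1) - c i)

/-! ### The geometric representation of a Coxeter group -/

/-- The linear form `x ↦ 2⟨x, α_i⟩` on the space spanned by the simple roots. -/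
noncomputable def coroot (M : CoxeterMatrix B) (i : B) : (B →₀ ℝ) →ₗ[ℝ] ℝ :=
  Finsupp.linearCombination ℝ fun j => -2 * Real.cos (Real.pi / M i j)

/-- The simple root indexed by `i`. -/
noncomputable def root (i : B) : B →₀ ℝ := Finsupp.single i 1

/-- The reflection in the simple root indexed by `i`. -/
noncomputable def refl (M : CoxeterMatrix B) (i : B) : Module.End ℝ (B →₀ ℝ) :=
  LinearMap.id - (coroot M i).smulRight (root i)

lemma refl_apply (i : B) (x : B →₀ ℝ) : refl M i x = x - coroot M i x • root i := by
  simp [refl]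

lemma coroot_root (i j : B) : coroot M i (root j) = -2 * Real.cos (Real.pi / M i j) := by
  simp [coroot, root]

lemma coroot_root_self (i : B) : coroot M i (root i) = 2 := by
  simp [coroot_root]

lemma refl_root_self (i : B) : refl M i (root i) = -root i := by
  rw [refl_apply, coroot_root_self, two_smul]; abel

lemma refl_refl (i : B) (x : B →₀ ℝ) : refl M i (refl M i x) = x := by
  rw [refl_apply i x, map_sub, map_smul, refl_root_self, refl_apply]; simp

lemma refl_mul_self (i : B) : refl M i * refl M i = 1 :=
  LinearMap.ext fun x => by rw [Module.End.mul_apply, refl_refl, Module.End.one_apply]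

lemma root_nonneg (i : B) : 0 ≤ root i := by simp [root]

/-- The sequence `sin (k θ) / sin θ`, as a polynomial in `c = cos θ`. -/
def sinRatio (c : ℝ) : ℕ → ℝ
  | 0 => 0
  | 1 => 1
  | k + 2 => 2 * c * sinRatio c (k + 1) - sinRatio c k

lemma sinRatio_mul_sin (θ : ℝ) (k : ℕ) :
    sinRatio (Real.cos θ) k * Real.sin θ = Real.sin (k * θ) := by
  induction k using Nat.twoStepInduction with
  | zero => simp [sinRatio]
  | one => simp [sinRatio]
  | more k ih₀ ih₁ =>
    rw [sinRatio, sub_mul, mul_assoc, ih₀, ih₁]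
    have h₁ : ((k + 2 : ℕ) : ℝ) * θ = ((k + 1 : ℕ) : ℝ) * θ + θ := by push_cast; ring
    have h₀ : (k : ℝ) * θ = ((k + 1 : ℕ) : ℝ) * θ - θ := by push_cast; ring
    rw [h₁, h₀, Real.sin_add, Real.sin_sub]
    ring

lemma sinRatio_one (k : ℕ) : sinRatio 1 k = k := by
  induction k using Nat.twoStepInduction with
  | zero => simp [sinRatio]
  | one => simp [sinRatio]
  | more k ih₀ ih₁ => rw [sinRatio, ih₀, ih₁]; push_cast; ring

lemma sin_pi_div_pos {m : ℕ} (hm : 2 ≤ m) : 0 < Real.sin (Real.pi / m) := by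
  have hm' : (2 : ℝ) ≤ m := by exact_mod_cast hm
  apply Real.sin_pos_of_pos_of_lt_pi
  · have := Real.pi_pos; positivity
  · rw [div_lt_iff₀ (by linarith)]; nlinarith [Real.pi_pos]

lemma sinRatio_nonneg {m k : ℕ} (hm : m ≠ 1) (hk : m ≠ 0 → k ≤ m) :
    0 ≤ sinRatio (Real.cos (Real.pi / m)) k := by
  rcases Nat.eq_zero_or_pos m with rfl | hpos
  · simp [sinRatio_one]
  have h := sin_pi_div_pos (m := m) (by omega)
  have hm' : (0 : ℝ) < m := by exact_mod_cast hpos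
  have hk' : (k : ℝ) ≤ m := by exact_mod_cast hk hpos.ne'
  refine nonneg_of_mul_nonneg_left ?_ h
  rw [sinRatio_mul_sin]
  apply Real.sin_nonneg_of_nonneg_of_le_pi
  · have := Real.pi_pos; positivity
  · rw [mul_div_assoc', div_le_iff₀ hm']; nlinarith [Real.pi_pos]

lemma refl_combination_left (i j : B) (a b : ℝ) :
    refl M i (a • root i + b • root j) =
      (2 * Real.cos (Real.pi / M i j) * b - a) • root i + b • root j := by
  rw [refl_apply, map_add, map_smul, map_smul, coroot_root_self, coroot_root]
  simp only [smul_eq_mul]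
  module

lemma refl_combination_right (i j : B) (a b : ℝ) :
    refl M j (a • root i + b • root j) =
      a • root i + (2 * Real.cos (Real.pi / M i j) * a - b) • root j := by
  rw [add_comm, refl_combination_left, M.symmetric j i, add_comm]

lemma refl_mul_refl_pow_root (i j : B) (k : ℕ) :
    ((refl M i * refl M j) ^ k) (root i) =
      sinRatio (Real.cos (Real.pi / M i j)) (2 * k + 1) • root i +
        sinRatio (Real.cos (Real.pi / M i j)) (2 * k) • root j := by
  induction k with
  | zero => simp [sinRatio]
  | succ k ih =>
    rw [pow_succ', Module.End.mul_apply, ih, Module.End.mul_apply, refl_combination_right,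
      refl_combination_left]
    rfl

lemma refl_mul_refl_pow_order_root (i j : B) (hm : 2 ≤ M i j) :
    ((refl M i * refl M j) ^ M i j) (root i) = root i := by
  have hs := sin_pi_div_pos hm
  have hm' : (M i j : ℝ) ≠ 0 := by positivity
  have h₀ : sinRatio (Real.cos (Real.pi / M i j)) (2 * M i j) = 0 := by
    have h := sinRatio_mul_sin (Real.pi / M i j) (2 * M i j)
    have e : ((2 * M i j : ℕ) : ℝ) * (Real.pi / M i j) = 2 * Real.pi := by
      push_cast; field_simp
    rw [e, Real.sin_two_pi] at h
    exact (mul_eq_zero.mp h).resolve_right hs.ne'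
  have h₁ : sinRatio (Real.cos (Real.pi / M i j)) (2 * M i j + 1) = 1 := by
    have h := sinRatio_mul_sin (Real.pi / M i j) (2 * M i j + 1)
    have e : ((2 * M i j + 1 : ℕ) : ℝ) * (Real.pi / M i j) =
        Real.pi / M i j + 2 * Real.pi := by
      push_cast; field_simp; ring
    rw [e, Real.sin_add_two_pi] at h
    exact mul_right_cancel₀ hs.ne' (by rw [h, one_mul])
  rw [refl_mul_refl_pow_root, h₀, h₁]
  simp

lemma refl_mul_refl_pow_order_root' (i j : B) (hm : 2 ≤ M i j) :
    ((refl M i * refl M j) ^ M i j) (root j) = root j := by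
  have h := refl_mul_refl_pow_order_root j i (M.symmetric i j ▸ hm)
  have hinv : (refl M i * refl M j) * (refl M j * refl M i) = 1 := by
    rw [mul_assoc, ← mul_assoc (refl M j), refl_mul_self, one_mul, refl_mul_self]
  have hinv' : (refl M j * refl M i) * (refl M i * refl M j) = 1 := by
    rw [mul_assoc, ← mul_assoc (refl M i), refl_mul_self, one_mul, refl_mul_self]
  have hc : Commute (refl M i * refl M j) (refl M j * refl M i) := by
    rw [Commute, SemiconjBy, hinv, hinv']
  rw [M.symmetric j i] at h
  nth_rw 1 [← h]
  rw [← Module.End.mul_apply, ← hc.mul_pow, hinv, one_pow, Module.End.one_apply]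

lemma refl_mul_refl_pow_eq_self (i j : B) {x : B →₀ ℝ} (hi : coroot M i x = 0)
    (hj : coroot M j x = 0) (k : ℕ) : ((refl M i * refl M j) ^ k) x = x := by
  induction k with
  | zero => simp
  | succ k ih => rw [pow_succ', Module.End.mul_apply, ih]; simp [refl_apply, hi, hj]

lemma refl_isLiftable (M : CoxeterMatrix B) : M.IsLiftable (refl M) := by
  intro i j
  by_cases hij : i = j
  · subst hij; simp [refl_mul_self]
  rcases Nat.eq_zero_or_pos (M i j) with h0 | hpos
  · rw [h0, pow_zero]
  have hm : 2 ≤ M i j := by have := M.off_diagonal i j hij; omega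
  refine LinearMap.ext fun x => ?_
  set c := Real.cos (Real.pi / M i j) with hc
  have hs := sin_pi_div_pos hm
  have hdet : 1 - c ^ 2 ≠ 0 := by
    have := Real.sin_sq_add_cos_sq (Real.pi / M i j)
    have h2 : 1 - c ^ 2 = Real.sin (Real.pi / M i j) ^ 2 := by rw [hc]; linarith
    rw [h2]; positivity
  obtain ⟨a, b, ha, hb⟩ : ∃ a b : ℝ, 2 * a - 2 * c * b = coroot M i x ∧
      2 * b - 2 * c * a = coroot M j x := by
    refine ⟨(coroot M i x + c * coroot M j x) / (2 * (1 - c ^ 2)),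
      (coroot M j x + c * coroot M i x) / (2 * (1 - c ^ 2)), ?_, ?_⟩ <;> field_simp <;> ring
  have hji : coroot M j (root i) = -2 * c := by rw [coroot_root, M.symmetric j i]
  have hij' : coroot M i (root j) = -2 * c := by rw [coroot_root]
  have key := refl_mul_refl_pow_eq_self (M := M) i j (x := x - (a • root i + b • root j))
    (by simp only [map_sub, map_add, map_smul, smul_eq_mul, coroot_root_self, hij']; linarith)
    (by simp only [map_sub, map_add, map_smul, smul_eq_mul, coroot_root_self, hji]; linarith)
    (M i j)
  rw [map_sub, map_add, map_smul, map_smul, refl_mul_refl_pow_order_root i j hm,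
    refl_mul_refl_pow_order_root' i j hm] at key
  simpa using key

/-- The geometric representation. -/
noncomputable def geomRep (cs : CoxeterSystem M W) : W →* Module.End ℝ (B →₀ ℝ) :=
  cs.lift ⟨refl M, refl_isLiftable M⟩

lemma geomRep_simple (cs : CoxeterSystem M W) (i : B) : geomRep cs (cs.simple i) = refl M i :=
  cs.lift_apply_simple (refl_isLiftable M) i

lemma geomRep_mul_apply (cs : CoxeterSystem M W) (u v : W) (x : B →₀ ℝ) :
    geomRep cs (u * v) x = geomRep cs u (geomRep cs v x) := by
  rw [map_mul, Module.End.mul_apply]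

lemma geomRep_inv_apply_self (cs : CoxeterSystem M W) (w : W) (x : B →₀ ℝ) :
    geomRep cs w⁻¹ (geomRep cs w x) = x := by
  rw [← geomRep_mul_apply, inv_mul_cancel, map_one, Module.End.one_apply]

lemma geomRep_apply_inv_self (cs : CoxeterSystem M W) (w : W) (x : B →₀ ℝ) :
    geomRep cs w (geomRep cs w⁻¹ x) = x := by
  rw [← geomRep_mul_apply, mul_inv_cancel, map_one, Module.End.one_apply]

lemma geomRep_root_ne_zero (cs : CoxeterSystem M W) (w : W) (i : B) :
    geomRep cs w (root i) ≠ 0 := by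
  intro h
  have := geomRep_inv_apply_self cs w (root i)
  rw [h, map_zero] at this
  simp [root, eq_comm] at this

lemma geomRep_mul_simple_root (cs : CoxeterSystem M W) (w : W) (i : B) :
    geomRep cs (w * cs.simple i) (root i) = -geomRep cs w (root i) := by
  rw [geomRep_mul_apply, geomRep_simple, refl_root_self, map_neg]

open CoxeterSystem in
lemma geomRep_alternatingWord_root (cs : CoxeterSystem M W) (i j : B) (k : ℕ) :
    geomRep cs (cs.wordProd (alternatingWord i j k)) (root i) =
      if Even k then
        sinRatio (Real.cos (Real.pi / M i j)) (k + 1) • root i +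
          sinRatio (Real.cos (Real.pi / M i j)) k • root j
      else
        sinRatio (Real.cos (Real.pi / M i j)) k • root i +
          sinRatio (Real.cos (Real.pi / M i j)) (k + 1) • root j := by
  induction k with
  | zero => simp [sinRatio, alternatingWord]
  | succ k ih =>
    rw [alternatingWord_succ', cs.wordProd_cons, geomRep_mul_apply, ih, geomRep_simple]
    by_cases hk : Even k
    · have hk' : ¬ Even (k + 1) := by simpa [Nat.even_add_one] using hk
      rw [if_pos hk, if_pos hk, if_neg hk', refl_combination_right]
      rfl
    · have hk' : Even (k + 1) := by simpa [Nat.even_add_one] using hk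
      rw [if_neg hk, if_neg hk, if_pos hk', refl_combination_left]
      rfl

open CoxeterSystem in
/-- Every `w` factors with additive lengths as a minimal representative of its coset of the
dihedral parabolic subgroup `⟨s_i, s_j⟩` and an alternating word. -/
lemma exists_dihedral_factorization (cs : CoxeterSystem M W) (w : W) (i j : B)
    (hi : ¬ cs.IsRightDescent w i) :
    ∃ v k, w = v * cs.wordProd (alternatingWord i j k) ∧ cs.length w = cs.length v + k ∧
      ¬ cs.IsRightDescent v i ∧ ¬ cs.IsRightDescent v j := by
  induction hn : cs.length w using Nat.strong_induction_on generalizing w i j with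
  | _ n ih =>
    subst hn
    by_cases hj : cs.IsRightDescent w j
    · have hlen := cs.isRightDescent_iff.mp hj
      obtain ⟨v, k, hv, hk, h₁, h₂⟩ := ih _ hj (w * cs.simple j) j i
        (cs.isRightDescent_iff_not_isRightDescent_mul.mp hj) rfl
      refine ⟨v, k + 1, ?_, by omega, h₂, h₁⟩
      rw [alternatingWord_succ, cs.wordProd_concat, ← mul_assoc, ← hv,
        cs.simple_mul_simple_cancel_right]
    · exact ⟨w, 0, by simp [alternatingWord], by simp, hi, hj⟩

open CoxeterSystem in
lemma exists_alternatingWord_add (cs : CoxeterSystem M W) (i j : B) (a b : ℕ) :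
    ∃ x, cs.length x ≤ a ∧ cs.wordProd (alternatingWord i j (a + b)) =
      x * cs.wordProd (alternatingWord i j b) := by
  induction a with
  | zero => exact ⟨1, by simp, by simp⟩
  | succ a ih =>
    obtain ⟨x, hx, h⟩ := ih
    rw [Nat.add_right_comm, alternatingWord_succ', cs.wordProd_cons, h, ← mul_assoc]
    exact ⟨_, (cs.length_mul_le _ _).trans (by rw [cs.length_simple]; omega), rfl⟩

open CoxeterSystem in
lemma isRightDescent_mul_alternatingWord (cs : CoxeterSystem M W) (v : W) (i j : B) (k : ℕ)
    (hlen : cs.length (v * cs.wordProd (alternatingWord i j k)) = cs.length v + k)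
    (h0 : M i j ≠ 0) (hk : M i j ≤ k) :
    cs.IsRightDescent (v * cs.wordProd (alternatingWord i j k)) i := by
  obtain ⟨x, hx, h⟩ := exists_alternatingWord_add cs i j (k - M i j) (M i j)
  rw [Nat.sub_add_cancel hk] at h
  have hbraid : cs.wordProd (alternatingWord i j (M i j)) =
      cs.wordProd (alternatingWord i j (M i j - 1)) * cs.simple i := by
    have := cs.wordProd_braidWord_eq i j
    unfold braidWord at this
    rw [this, M.symmetric j i]
    obtain ⟨m, hm⟩ := Nat.exists_eq_succ_of_ne_zero h0
    rw [hm, Nat.succ_sub_one, alternatingWord_succ, cs.wordProd_concat]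
  unfold IsRightDescent
  rw [hlen, h, hbraid, ← mul_assoc, ← mul_assoc, cs.simple_mul_simple_cancel_right]
  have h₁ := cs.length_mul_le (v * x) (cs.wordProd (alternatingWord i j (M i j - 1)))
  have h₂ := cs.length_mul_le v x
  have h₃ := cs.length_wordProd_le (alternatingWord i j (M i j - 1))
  rw [length_alternatingWord] at h₃
  omega

theorem geomRep_root_nonneg (cs : CoxeterSystem M W) (w : W) (i : B)
    (hi : ¬ cs.IsRightDescent w i) : 0 ≤ geomRep cs w (root i) := by
  induction hn : cs.length w using Nat.strong_induction_on generalizing w i with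
  | _ n ih =>
    subst hn
    by_cases hw : w = 1
    · subst hw; simpa using root_nonneg i
    obtain ⟨j, hj⟩ := cs.exists_rightDescent_of_ne_one hw
    have hij : i ≠ j := by rintro rfl; exact hi hj
    obtain ⟨v, k, hv, hk, h₁, h₂⟩ := exists_dihedral_factorization cs w i j hi
    have hk0 : k ≠ 0 := by
      rintro rfl
      simp only [CoxeterSystem.alternatingWord, cs.wordProd_nil, mul_one] at hv
      exact h₂ (hv ▸ hj)
    have hkm : M i j ≠ 0 → k + 1 ≤ M i j := by
      intro h0
      by_contra hlt
      refine hi ?_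
      rw [hv]
      exact isRightDescent_mul_alternatingWord cs v i j k (hv ▸ hk) h0 (by omega)
    have p₁ := ih _ (by omega) v i h₁ rfl
    have p₂ := ih _ (by omega) v j h₂ rfl
    have c₁ := sinRatio_nonneg (M.off_diagonal i j hij) (k := k) fun h => by
      have := hkm h; omega
    have c₂ := sinRatio_nonneg (M.off_diagonal i j hij) hkm
    rw [hv, geomRep_mul_apply, geomRep_alternatingWord_root]
    split_ifs <;> rw [map_add, map_smul, map_smul] <;>
      exact add_nonneg (smul_nonneg (by assumption) p₁) (smul_nonneg (by assumption) p₂)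

theorem geomRep_root_nonpos (cs : CoxeterSystem M W) (w : W) (i : B)
    (hi : cs.IsRightDescent w i) : geomRep cs w (root i) ≤ 0 := by
  have h := geomRep_root_nonneg cs (w * cs.simple i) i
    (cs.isRightDescent_iff_not_isRightDescent_mul.mp hi)
  rw [geomRep_mul_simple_root] at h
  exact neg_nonneg.mp h

lemma geomRep_root_nonpos_iff (cs : CoxeterSystem M W) (w : W) (i : B) :
    geomRep cs w (root i) ≤ 0 ↔ ¬ 0 ≤ geomRep cs w (root i) := by
  constructor
  · intro h h'
    exact geomRep_root_ne_zero cs w i (le_antisymm h h')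
  · intro h
    by_cases hi : cs.IsRightDescent w i
    · exact geomRep_root_nonpos cs w i hi
    · exact absurd (geomRep_root_nonneg cs w i hi) h

lemma geomRep_conj_simple_apply (cs : CoxeterSystem M W) (w : W) (i : B) (x : B →₀ ℝ) :
    geomRep cs (w * cs.simple i * w⁻¹) x =
      x - coroot M i (geomRep cs w⁻¹ x) • geomRep cs w (root i) := by
  rw [geomRep_mul_apply, geomRep_mul_apply, geomRep_simple, refl_apply, map_sub, map_smul,
    geomRep_apply_inv_self]

lemma geomRep_conj_simple_root (cs : CoxeterSystem M W) (w : W) (i : B) :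
    geomRep cs (w * cs.simple i * w⁻¹) (geomRep cs w (root i)) = -geomRep cs w (root i) := by
  rw [geomRep_mul_apply, geomRep_inv_apply_self, geomRep_mul_simple_root]

lemma eq_one_of_geomRep_sub_mem_span (cs : CoxeterSystem M W) (g : W) (k : B)
    (hk : geomRep cs g (root k) = root k)
    (h : ∀ x, ∃ c : ℝ, geomRep cs g x = x + c • root k) : g = 1 := by
  by_contra hg
  obtain ⟨l, hl⟩ := cs.exists_rightDescent_of_ne_one hg
  have hneg := geomRep_root_nonpos cs g l hl
  by_cases hlk : l = k
  · subst hlk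
    have := (hk ▸ hneg : root l ≤ 0) l
    simp only [root, Finsupp.single_eq_same, Finsupp.coe_zero, Pi.zero_apply] at this
    linarith
  · obtain ⟨c, hc⟩ := h (root l)
    have := (hc ▸ hneg : root l + c • root k ≤ 0) l
    simp only [root, Finsupp.coe_add, Finsupp.coe_smul, Pi.add_apply, Pi.smul_apply,
      Finsupp.single_eq_same, Finsupp.single_eq_of_ne hlk, smul_eq_mul, mul_zero, add_zero,
      Finsupp.coe_zero, Pi.zero_apply] at this
    linarith

/-- The only positive root made negative by a simple reflection is the simple root itself. -/
lemma conj_simple_eq_simple (cs : CoxeterSystem M W) (w : W) (j k : B)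
    (hpos : 0 ≤ geomRep cs w (root j))
    (hneg : geomRep cs (cs.simple k * w) (root j) ≤ 0) :
    w * cs.simple j * w⁻¹ = cs.simple k := by
  set β := geomRep cs w (root j) with hβ
  rw [geomRep_mul_apply, geomRep_simple, refl_apply, ← hβ] at hneg
  have hβk : β = β k • root k := by
    ext l
    by_cases hlk : l = k
    · subst hlk; simp [root]
    · have h₁ := hneg l
      have h₂ := hpos l
      simp only [root, Finsupp.coe_sub, Finsupp.coe_smul, Pi.sub_apply, Pi.smul_apply,
        Finsupp.single_eq_of_ne hlk, smul_eq_mul, mul_zero, sub_zero, Finsupp.coe_zero,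
        Pi.zero_apply] at h₁ h₂ ⊢
      linarith
  have hk0 : β k ≠ 0 := by
    intro h0
    rw [h0, zero_smul] at hβk
    exact geomRep_root_ne_zero cs w j hβk
  have hrefl : geomRep cs (w * cs.simple j * w⁻¹) (root k) = -root k := by
    have h := geomRep_conj_simple_root cs w j
    rw [← hβ, hβk, map_smul, ← smul_neg] at h
    exact smul_right_injective _ hk0 h
  have hone : w * cs.simple j * w⁻¹ * cs.simple k = 1 := by
    apply eq_one_of_geomRep_sub_mem_span cs _ k
    · rw [geomRep_mul_apply, geomRep_simple, refl_root_self, map_neg, hrefl, neg_neg]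
    · intro x
      rw [geomRep_mul_apply, geomRep_simple, refl_apply, geomRep_conj_simple_apply, ← hβ, hβk]
      exact ⟨-coroot M k x - coroot M j (geomRep cs w⁻¹ (x - coroot M k x • root k)) * β k,
        by module⟩
  rw [mul_eq_one_iff_eq_inv, cs.inv_simple] at hone
  exact hone

/-! ### Sides of walls -/

lemma length_conj_simple_mul_lt (cs : CoxeterSystem M W) (w : W) (i : B)
    (hpos : 0 ≤ geomRep cs w (root i)) (x : W)
    (hx : geomRep cs (x⁻¹ * w) (root i) ≤ 0) :
    cs.length (w * cs.simple i * w⁻¹ * x) < cs.length x := by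
  induction hn : cs.length x using Nat.strong_induction_on generalizing x with
  | _ n ih =>
    subst hn
    by_cases hx1 : x = 1
    · subst hx1
      rw [inv_one, one_mul] at hx
      exact absurd hpos ((geomRep_root_nonpos_iff cs w i).mp hx)
    obtain ⟨k, hk⟩ := cs.exists_rightDescent_of_ne_one hx1
    have hlen := cs.isRightDescent_iff.mp hk
    by_cases h : geomRep cs ((x * cs.simple k)⁻¹ * w) (root i) ≤ 0
    · have h₁ := ih _ hk (x * cs.simple k) h rfl
      have h₂ := cs.length_mul_le (w * cs.simple i * w⁻¹ * (x * cs.simple k)) (cs.simple k)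
      rw [← mul_assoc, cs.simple_mul_simple_cancel_right, cs.length_simple] at h₂
      rw [← mul_assoc] at h₁
      omega
    · rw [geomRep_root_nonpos_iff, not_not] at h
      have e := conj_simple_eq_simple cs _ i k h (by
        rwa [mul_inv_rev, cs.inv_simple, mul_assoc, cs.simple_mul_simple_cancel_left])
      have e' : w * cs.simple i * w⁻¹ * x = x * cs.simple k := by
        have := congrArg (fun g => x * cs.simple k * g * cs.simple k) e
        simpa [mul_assoc] using this
      rwa [e']

lemma length_conj_simple_mul_lt_iff (cs : CoxeterSystem M W) (w : W) (i : B)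
    (hpos : 0 ≤ geomRep cs w (root i)) (x : W) :
    cs.length (w * cs.simple i * w⁻¹ * x) < cs.length x ↔
      geomRep cs (x⁻¹ * w) (root i) ≤ 0 := by
  refine ⟨fun h => ?_, length_conj_simple_mul_lt cs w i hpos x⟩
  by_contra hx
  rw [geomRep_root_nonpos_iff, not_not] at hx
  have h' := length_conj_simple_mul_lt cs w i hpos (w * cs.simple i * w⁻¹ * x) (by
    have e : (w * cs.simple i * w⁻¹ * x)⁻¹ * w = x⁻¹ * w * cs.simple i := by
      simp [mul_assoc]
    rw [e, geomRep_mul_simple_root]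
    exact neg_nonpos.mpr hx)
  have e : w * cs.simple i * w⁻¹ * (w * cs.simple i * w⁻¹ * x) = x := by simp [mul_assoc]
  rw [e] at h'
  omega

lemma sameSide_conj_simple_iff (cs : CoxeterSystem M W) (w : W) (i : B) (u v : W) :
    SameSide cs (w * cs.simple i * w⁻¹) u v ↔
      (geomRep cs (u⁻¹ * w) (root i) ≤ 0 ↔ geomRep cs (v⁻¹ * w) (root i) ≤ 0) := by
  unfold SameSide
  by_cases hpos : 0 ≤ geomRep cs w (root i)
  · rw [length_conj_simple_mul_lt_iff cs w i hpos, length_conj_simple_mul_lt_iff cs w i hpos]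
  · have hneg : 0 ≤ geomRep cs (w * cs.simple i) (root i) := by
      rw [geomRep_mul_simple_root]
      exact neg_nonneg.mpr ((geomRep_root_nonpos_iff cs w i).mpr hpos)
    have e : w * cs.simple i * w⁻¹ = w * cs.simple i * cs.simple i * (w * cs.simple i)⁻¹ := by
      simp [mul_assoc]
    have flip (g : W) : geomRep cs (g⁻¹ * (w * cs.simple i)) (root i) ≤ 0 ↔
        ¬ geomRep cs (g⁻¹ * w) (root i) ≤ 0 := by
      rw [← mul_assoc, geomRep_mul_simple_root, neg_nonpos, geomRep_root_nonpos_iff, not_not]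
    rw [e, length_conj_simple_mul_lt_iff cs _ i hneg, length_conj_simple_mul_lt_iff cs _ i hneg,
      flip, flip, not_iff_not]

section Sides

variable {cs : CoxeterSystem M W} {r t u v x : W}

lemma SameSide.symm (h : SameSide cs t u v) : SameSide cs t v u := Iff.symm h

lemma SameSide.trans (h : SameSide cs t u v) (h' : SameSide cs t v x) : SameSide cs t u x :=
  Iff.trans h h'

lemma SeparatesPts.symm (h : SeparatesPts cs t u v) : SeparatesPts cs t v u :=
  fun h' => h h'.symm

lemma SeparatesPts.trans (h : SeparatesPts cs t u v) (h' : SeparatesPts cs t v x) :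
    SameSide cs t u x := by
  unfold SeparatesPts SameSide at *
  tauto

lemma SeparatesPts.trans_sameSide (h : SeparatesPts cs t u v) (h' : SameSide cs t v x) :
    SeparatesPts cs t u x := fun h'' => h (h''.trans h'.symm)

lemma SameSide.trans_separatesPts (h : SameSide cs t u v) (h' : SeparatesPts cs t v x) :
    SeparatesPts cs t u x := fun h'' => h' (h.symm.trans h'')

lemma sameSide_conj_mul_iff (ht : cs.IsReflection t) (g : W) :
    SameSide cs (g * t * g⁻¹) (g * u) (g * v) ↔ SameSide cs t u v := by
  obtain ⟨w, i, rfl⟩ := ht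
  have e : g * (w * cs.simple i * w⁻¹) * g⁻¹ = g * w * cs.simple i * (g * w)⁻¹ := by
    simp [mul_assoc]
  have e' (y : W) : (g * y)⁻¹ * (g * w) = y⁻¹ * w := by group
  rw [e, sameSide_conj_simple_iff, sameSide_conj_simple_iff, e', e']

lemma separatesPts_mul_self (ht : cs.IsReflection t) (u : W) :
    SeparatesPts cs t u (t * u) := by
  have e : t * (t * u) = u := by rw [← mul_assoc, ht.mul_self, one_mul]
  have := ht.length_mul_right_ne u
  unfold SeparatesPts SameSide
  rw [e]
  omega

lemma mul_eq_mul_simple_of_separatesPts (ht : cs.IsReflection t) {k : B}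
    (h : SeparatesPts cs t u (u * cs.simple k)) : t * u = u * cs.simple k := by
  obtain ⟨w, i, rfl⟩ := ht
  unfold SeparatesPts at h
  rw [sameSide_conj_simple_iff, mul_inv_rev, cs.inv_simple, mul_assoc (cs.simple k)] at h
  by_cases hu : geomRep cs (u⁻¹ * w) (root i) ≤ 0
  · have e := conj_simple_eq_simple cs (u⁻¹ * w * cs.simple i) i k
      (by rw [geomRep_mul_simple_root]; exact neg_nonneg.mpr hu)
      (by
        rw [← mul_assoc, geomRep_mul_simple_root, neg_nonpos]
        have : ¬ geomRep cs (cs.simple k * (u⁻¹ * w)) (root i) ≤ 0 := by tauto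
        rwa [geomRep_root_nonpos_iff, not_not] at this)
    rw [← e]
    simp [mul_assoc]
  · have e := conj_simple_eq_simple cs (u⁻¹ * w) i k
      (by rwa [geomRep_root_nonpos_iff, not_not] at hu) (by tauto)
    rw [← e]
    simp [mul_assoc]

/-- If the wall of `t` separates each of two vertices on one side of the wall of `r` from its
mirror image under `r`, then both vertices lie on the same side of the wall of `t`. -/
lemma sameSide_of_separatesPts_mirror (hr : cs.IsReflection r) (ht : cs.IsReflection t)
    (huv : SameSide cs r u v) (hu : SeparatesPts cs t u (r * u))
    (hv : SeparatesPts cs t v (r * v)) : SameSide cs t u v := by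
  obtain ⟨w, i, rfl⟩ := hr
  obtain ⟨x, j, rfl⟩ := ht
  set c := coroot M i (geomRep cs w⁻¹ (geomRep cs x (root j)))
  have mirror (g : W) : geomRep cs ((w * cs.simple i * w⁻¹ * g)⁻¹ * x) (root j) =
      geomRep cs (g⁻¹ * x) (root j) - c • geomRep cs (g⁻¹ * w) (root i) := by
    have e : (w * cs.simple i * w⁻¹ * g)⁻¹ * x = g⁻¹ * (w * cs.simple i * w⁻¹ * x) := by
      simp [mul_assoc]
    rw [e, geomRep_mul_apply, geomRep_mul_apply, geomRep_conj_simple_apply, map_sub, map_smul,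
      geomRep_mul_apply, geomRep_mul_apply]
  have pos (g : W) (hc : 0 ≤ c • geomRep cs (g⁻¹ * w) (root i))
      (h : SeparatesPts cs (x * cs.simple j * x⁻¹) g (w * cs.simple i * w⁻¹ * g)) :
      ¬ geomRep cs (g⁻¹ * x) (root j) ≤ 0 := by
    intro hg
    unfold SeparatesPts at h
    rw [sameSide_conj_simple_iff, mirror] at h
    exact h ⟨fun _ => (sub_le_self _ hc).trans hg, fun _ => hg⟩
  have neg (g : W) (hc : c • geomRep cs (g⁻¹ * w) (root i) ≤ 0)
      (h : SeparatesPts cs (x * cs.simple j * x⁻¹) g (w * cs.simple i * w⁻¹ * g)) :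
      geomRep cs (g⁻¹ * x) (root j) ≤ 0 := by
    by_contra hg
    unfold SeparatesPts at h
    rw [sameSide_conj_simple_iff, mirror] at h
    exact h ⟨fun h' => absurd h' hg, fun h' => (sub_nonpos.mp h').trans hc⟩
  rw [sameSide_conj_simple_iff] at huv ⊢
  by_cases hun : geomRep cs (u⁻¹ * w) (root i) ≤ 0
  · have hvn := huv.mp hun
    rcases le_total 0 c with hc | hc
    · exact iff_of_true (neg u (smul_nonpos_of_nonneg_of_nonpos hc hun) hu)
        (neg v (smul_nonpos_of_nonneg_of_nonpos hc hvn) hv)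
    · exact iff_of_false (pos u (smul_nonneg_of_nonpos_of_nonpos hc hun) hu)
        (pos v (smul_nonneg_of_nonpos_of_nonpos hc hvn) hv)
  · have hvn := mt huv.mpr hun
    rw [geomRep_root_nonpos_iff, not_not] at hun hvn
    rcases le_total 0 c with hc | hc
    · exact iff_of_false (pos u (smul_nonneg hc hun) hu) (pos v (smul_nonneg hc hvn) hv)
    · exact iff_of_true (neg u (smul_nonpos_of_nonpos_of_nonneg hc hun) hu)
        (neg v (smul_nonpos_of_nonpos_of_nonneg hc hvn) hv)

/-! ### Walls and distances -/

lemma d_comm (u v : W) : d cs u v = d cs v u := by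
  rw [d, d, ← cs.length_inv, mul_inv_rev, inv_inv]

lemma d_self (u : W) : d cs u u = 0 := by simp [d]

lemma d_triangle (u v x : W) : d cs u x ≤ d cs u v + d cs v x := by
  have := cs.length_mul_le (u⁻¹ * v) (v⁻¹ * x)
  rwa [mul_assoc, mul_inv_cancel_left] at this

lemma d_mul_left (g u v : W) : d cs (g * u) (g * v) = d cs u v := by
  simp [d, mul_assoc]

lemma d_mul_simple (u : W) (i : B) : d cs u (u * cs.simple i) = 1 := by
  simp [d]

lemma exists_d_mul_simple_add_one (h : u ≠ v) :
    ∃ i, d cs u (v * cs.simple i) + 1 = d cs u v := by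
  obtain ⟨i, hi⟩ := cs.exists_rightDescent_of_ne_one (w := u⁻¹ * v) fun h' =>
    h (inv_mul_eq_one.mp h')
  exact ⟨i, by rw [d, ← mul_assoc]; exact cs.isRightDescent_iff.mp hi⟩

lemma separatesPts_iff_d_lt (ht : cs.IsReflection t) :
    SeparatesPts cs t u v ↔ d cs u (t * v) < d cs u v := by
  have ht' : cs.IsReflection (u⁻¹ * t * u) := by simpa using ht.conj u⁻¹
  have e : u * (u⁻¹ * t * u) * u⁻¹ = t := by group
  have h := sameSide_conj_mul_iff (u := 1) (v := u⁻¹ * v) ht' u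
  rw [e, mul_one, mul_inv_cancel_left] at h
  have h1 : ¬ cs.length (u⁻¹ * t * u * 1) < cs.length 1 := by simp
  have e' : u⁻¹ * t * u * (u⁻¹ * v) = u⁻¹ * (t * v) := by group
  rw [SeparatesPts, h, SameSide, e', d, d]
  tauto

/-- A geodesic crosses each wall at most once. -/
lemma not_separatesPts_of_between (ht : cs.IsReflection t)
    (h : d cs u v + d cs v x = d cs u x) (h₁ : SeparatesPts cs t u v) :
    SameSide cs t v x := by
  by_contra h₂
  have l₁ := (separatesPts_iff_d_lt ht).mp h₁
  have l₂ := (separatesPts_iff_d_lt ht).mp (SeparatesPts.symm h₂)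
  have := d_triangle (cs := cs) u (t * v) x
  rw [d_comm x, d_comm x] at l₂
  omega

/-- A geodesic between two vertices separated by a wall meets that wall. -/
lemma exists_inWallBar_between (ht : cs.IsReflection t) (h : SeparatesPts cs t u v) :
    ∃ x, InWallBar cs t x ∧ d cs u x < d cs u v ∧ d cs u x + d cs x v = d cs u v := by
  induction hn : d cs u v using Nat.strong_induction_on generalizing v with
  | _ n ih =>
    subst hn
    have huv : u ≠ v := by rintro rfl; exact h Iff.rfl
    obtain ⟨i, hi⟩ := exists_d_mul_simple_add_one (cs := cs) huv
    have h1 : d cs (v * cs.simple i) v = 1 := by rw [d_comm, d_mul_simple]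
    by_cases hs : SameSide cs t u (v * cs.simple i)
    · refine ⟨v * cs.simple i, ⟨i, ?_⟩, by omega, by omega⟩
      have hsep : SeparatesPts cs t (v * cs.simple i) (v * cs.simple i * cs.simple i) := by
        rw [cs.simple_mul_simple_cancel_right]
        exact hs.symm.trans_separatesPts h
      exact mul_eq_mul_simple_of_separatesPts ht hsep
    · obtain ⟨x, hx, hlt, hadd⟩ := ih _ (by omega) hs rfl
      refine ⟨x, hx, by omega, ?_⟩
      have := d_triangle (cs := cs) u x v
      have := d_triangle (cs := cs) x (v * cs.simple i) v
      omega

/-- The reflections whose walls separate `u` and `v`. -/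
def separators (cs : CoxeterSystem M W) (u v : W) : Set W :=
  {t | cs.IsReflection t ∧ SeparatesPts cs t u v}

lemma separators_finite_and_ncard_le (u v : W) :
    (separators cs u v).Finite ∧ (separators cs u v).ncard ≤ d cs u v := by
  induction hn : d cs u v using Nat.strong_induction_on generalizing v with
  | _ n ih =>
    subst hn
    by_cases huv : u = v
    · subst huv
      have : separators cs u u = ∅ := by
        ext t; simp [separators, SeparatesPts, SameSide]
      simp [this]
    obtain ⟨i, hi⟩ := exists_d_mul_simple_add_one (cs := cs) huv
    obtain ⟨hfin, hcard⟩ := ih _ (by omega) (v * cs.simple i) rfl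
    have hsub : separators cs u v ⊆
        insert (v * cs.simple i * v⁻¹) (separators cs u (v * cs.simple i)) := by
      rintro t ⟨ht, hsep⟩
      by_cases hs : SameSide cs t v (v * cs.simple i)
      · exact Or.inr ⟨ht, hsep.trans_sameSide hs⟩
      · refine Or.inl ?_
        rw [← mul_eq_mul_simple_of_separatesPts ht hs, mul_inv_cancel_right]
    refine ⟨(hfin.insert _).subset hsub, ?_⟩
    have h₁ := Set.ncard_le_ncard hsub (hfin.insert _)
    have h₂ := Set.ncard_insert_le (v * cs.simple i * v⁻¹) (separators cs u (v * cs.simple i))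
    omega

/-- The reflections whose walls separate the wall of `t` from `v`. -/
def wallSeparators (cs : CoxeterSystem M W) (t v : W) : Set W :=
  {r | cs.IsReflection r ∧ SepWallFromPt cs r t v}

lemma exists_inWallBar (ht : cs.IsReflection t) : ∃ x, InWallBar cs t x := by
  obtain ⟨w, i, rfl⟩ := ht
  exact ⟨w, i, by simp⟩

lemma exists_d_eq_wallDist (ht : cs.IsReflection t) (v : W) :
    ∃ x, InWallBar cs t x ∧ d cs v x = wallDist cs t v := by
  obtain ⟨x, hx⟩ := exists_inWallBar ht
  exact Nat.sInf_mem (s := {n | ∃ x, InWallBar cs t x ∧ d cs v x = n}) ⟨_, x, hx, rfl⟩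

lemma wallDist_le (h : InWallBar cs t x) (v : W) : wallDist cs t v ≤ d cs v x :=
  Nat.sInf_le ⟨x, h, rfl⟩

lemma wallDist_le_add (ht : cs.IsReflection t) (u v : W) :
    wallDist cs t u ≤ d cs u v + wallDist cs t v := by
  obtain ⟨x, hx, h⟩ := exists_d_eq_wallDist ht v
  rw [← h]
  exact (wallDist_le hx u).trans (d_triangle u v x)

lemma wallSeparators_finite (ht : cs.IsReflection t) (v : W) :
    (wallSeparators cs t v).Finite := by
  obtain ⟨x, hx⟩ := exists_inWallBar ht
  exact (separators_finite_and_ncard_le x v).1.subset fun r hr => ⟨hr.1, hr.2 x hx⟩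

lemma d_mul_self_le (ht : cs.IsReflection t) (v : W) :
    d cs v (t * v) ≤ 2 * wallDist cs t v + 1 := by
  obtain ⟨x, ⟨i, hi⟩, h⟩ := exists_d_eq_wallDist ht v
  have h₁ := d_triangle (cs := cs) v x (t * v)
  have h₂ := d_triangle (cs := cs) x (t * x) (t * v)
  have h₃ : d cs x (t * x) = 1 := by rw [hi, d_mul_simple]
  rw [d_mul_left, d_comm x v] at h₂
  omega

/-- A wall separating `v` from a wall which itself separates `v` from the wall of `t`
separates `v` from the wall of `t`. -/
lemma wallSeparators_subset (hr : r ∈ wallSeparators cs t v) :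
    wallSeparators cs r v ⊆ wallSeparators cs t v := by
  rintro p ⟨hp, hsep⟩
  refine ⟨hp, fun q hq => ?_⟩
  obtain ⟨x, hx, -, hadd⟩ := exists_inWallBar_between hr.1 (hr.2 q hq).symm
  exact (not_separatesPts_of_between hp hadd (hsep x hx).symm).symm.trans_separatesPts (hsep x hx)

/-- If `v` is at distance at least `P 1` from the wall of `t`, some wall closer than `P 1` to `v`
separates them. -/
lemma exists_near_wallSeparator {P : ℕ → ℕ} (hP : IsParallelWallFn cs P)
    (ht : cs.IsReflection t) (hv : P 1 ≤ wallDist cs t v) :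
    ∃ r ∈ wallSeparators cs t v, wallDist cs r v < P 1 := by
  have exists_sep {p : W} (hp : cs.IsReflection p) (h : P 1 ≤ wallDist cs p v) :
      ∃ r, r ∈ wallSeparators cs p v := by
    obtain ⟨T, hcard, hrefl, -, hsep⟩ := hP 1 one_pos p v hp h
    obtain ⟨r, rfl⟩ := Finset.card_eq_one.mp hcard
    exact ⟨r, hrefl r (by simp), hsep r (by simp)⟩
  obtain ⟨r, hr, hmin⟩ := (wallSeparators_finite ht v).exists_minimalFor
    (fun r => wallDist cs r v) _ (exists_sep ht hv)
  refine ⟨r, hr, ?_⟩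
  by_contra! hfar
  obtain ⟨p, hp⟩ := exists_sep hr.1 hfar
  obtain ⟨x, hx, hxd⟩ := exists_d_eq_wallDist hr.1 v
  obtain ⟨y, hy, hlt, -⟩ := exists_inWallBar_between hp.1 (hp.2 x hx).symm
  have h₁ : wallDist cs p v < wallDist cs r v := by
    have := wallDist_le hy v
    omega
  have h₂ := hmin (wallSeparators_subset hr hp) h₁.le
  simp only at h₂
  omega

/-- Reflecting `v` in a wall separating it from the wall of `t` lowers the number of walls
separating it from the wall of `t`. -/
lemma ncard_wallSeparators_mul_lt (ht : cs.IsReflection t) (hr : r ∈ wallSeparators cs t v) :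
    (wallSeparators cs t (r * v)).ncard < (wallSeparators cs t v).ncard := by
  classical
  have hfin := wallSeparators_finite ht v
  obtain ⟨hrefl, hrsep⟩ := hr
  have hrr : r * (r * v) = v := by rw [← mul_assoc, hrefl.mul_self, one_mul]
  have conj_side {p x y : W} (hp : cs.IsReflection p) :
      SameSide cs (r * p * r) (r * x) (r * y) ↔ SameSide cs p x y := by
    have := sameSide_conj_mul_iff (u := x) (v := y) hp r
    rwa [hrefl.inv] at this
  have conj_sep {p : W} (hp : cs.IsReflection p) (h : SeparatesPts cs p v (r * v)) :
      SeparatesPts cs (r * p * r) v (r * v) := fun h' => by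
    have := (conj_side (x := r * v) (y := v) hp).mp (by rwa [hrr])
    exact h this.symm
  let f : W → W := fun p => if SameSide cs p v (r * v) then p else r * p * r
  have hmaps : ∀ p ∈ wallSeparators cs t (r * v), f p ∈ wallSeparators cs t v \ {r} := by
    rintro p ⟨hp, hpsep⟩
    by_cases hs : SameSide cs p v (r * v)
    · simp only [f, if_pos hs]
      refine ⟨⟨hp, fun q hq => (hpsep q hq).trans_sameSide hs.symm⟩, ?_⟩
      rintro rfl
      exact separatesPts_mul_self hrefl v hs
    · simp only [f, if_neg hs]
      have hside (q : W) (hq : InWallBar cs t q) : SameSide cs p q v :=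
        (hpsep q hq).trans (SeparatesPts.symm hs)
      have hpc : cs.IsReflection (r * p * r) := by simpa [hrefl.inv] using hp.conj r
      have hsc := conj_sep hp hs
      refine ⟨⟨hpc, fun q hq hqv => ?_⟩, ?_⟩
      · have hrq : r * (r * q) = q := by rw [← mul_assoc, hrefl.mul_self, one_mul]
        have hqz : SameSide cs (r * p * r) (r * q) (r * v) := (conj_side hp).mpr (hside q hq)
        have hqq : SeparatesPts cs (r * p * r) (r * q) (r * (r * q)) := by
          rw [hrq]
          exact (hqz.trans_separatesPts hsc.symm).trans_sameSide hqv.symm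
        have hvq : SameSide cs r v (r * q) :=
          (hrsep q hq).symm.trans (separatesPts_mul_self hrefl q)
        exact hsc ((sameSide_of_separatesPts_mirror hrefl hpc hvq hsc hqq).trans hqz)
      · intro he
        have hpr : p = r := by
          have h := congrArg (fun g => r * g * r) (Set.mem_singleton_iff.mp he)
          have e : r * (r * p * r) * r = r * r * p * (r * r) := by group
          simpa [e, hrefl.mul_self] using h
        obtain ⟨q, hq⟩ := exists_inWallBar ht
        exact hrsep q hq (hpr ▸ hside q hq)
  have hinj : Set.InjOn f (wallSeparators cs t (r * v)) := by
    rintro p ⟨hp, -⟩ p' ⟨hp', -⟩ h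
    by_cases hs : SameSide cs p v (r * v) <;> by_cases hs' : SameSide cs p' v (r * v) <;>
      simp only [f, hs, hs', if_true, if_false] at h
    · exact h
    · exact absurd (h ▸ hs) (conj_sep hp' hs')
    · exact absurd (h ▸ hs') (conj_sep hp hs)
    · exact mul_left_cancel (mul_right_cancel h)
  calc (wallSeparators cs t (r * v)).ncard
      ≤ (wallSeparators cs t v \ {r}).ncard :=
        Set.ncard_le_ncard_of_injOn f hmaps hinj hfin.sdiff
    _ < (wallSeparators cs t v).ncard :=
        Set.ncard_sdiff_singleton_lt_of_mem ⟨hrefl, hrsep⟩ hfin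

lemma wallDist_le_of_ncard_wallSeparators {P : ℕ → ℕ} (hP : IsParallelWallFn cs P)
    (ht : cs.IsReflection t) (v : W) :
    wallDist cs t v ≤ (wallSeparators cs t v).ncard * (2 * P 1 + 1) + P 1 := by
  induction hn : (wallSeparators cs t v).ncard using Nat.strong_induction_on generalizing v with
  | _ n ih =>
    subst hn
    by_cases hv : P 1 ≤ wallDist cs t v
    · obtain ⟨r, hr, hnear⟩ := exists_near_wallSeparator hP ht hv
      have hlt := ncard_wallSeparators_mul_lt ht hr
      have h₁ := ih _ hlt (r * v) rfl
      have h₂ := wallDist_le_add ht v (r * v)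
      have h₃ := d_mul_self_le hr.1 v
      have h₄ := Nat.mul_le_mul_right (2 * P 1 + 1) (Nat.succ_le_of_lt hlt)
      rw [Nat.succ_mul] at h₄
      omega
    · omega

lemma ncard_wallSeparators_le {a b : W} {A : ℕ} (ht : cs.IsReflection t)
    (ha : wallDist cs t a ≤ A) (hb : wallDist cs t b ≤ A)
    (h : d cs a v + d cs v b = d cs a b) : (wallSeparators cs t v).ncard ≤ 2 * A := by
  obtain ⟨x, hx, hax⟩ := exists_d_eq_wallDist ht a
  obtain ⟨y, hy, hby⟩ := exists_d_eq_wallDist ht b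
  obtain ⟨hfx, hcx⟩ := separators_finite_and_ncard_le (cs := cs) a x
  obtain ⟨hfy, hcy⟩ := separators_finite_and_ncard_le (cs := cs) b y
  have hsub : wallSeparators cs t v ⊆ separators cs a x ∪ separators cs b y := by
    rintro r ⟨hr, hsep⟩
    by_cases hs : SameSide cs r a x
    · have hav := hs.trans_separatesPts (hsep x hx)
      have hvb := not_separatesPts_of_between hr h hav
      exact Or.inr ⟨hr, fun h' => hsep y hy (h'.symm.trans hvb.symm)⟩
    · exact Or.inl ⟨hr, hs⟩
  have h₁ := Set.ncard_le_ncard hsub (hfx.union hfy)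
  have h₂ := Set.ncard_union_le (separators cs a x) (separators cs b y)
  omega

lemma IsPath.d_le {v : ℕ → W} {n : ℕ} (h : IsPath cs v n) (j k : ℕ) (hk : j + k ≤ n) :
    d cs (v j) (v (j + k)) ≤ k := by
  induction k with
  | zero => simp [d_self]
  | succ k ih =>
    obtain ⟨i, hi⟩ := h (j + k) (by omega)
    have h₁ := d_triangle (cs := cs) (v j) (v (j + k)) (v (j + k + 1))
    have h₂ : d cs (v (j + k)) (v (j + k + 1)) = 1 := by rw [hi, d_mul_simple]
    have h₃ := ih (by omega)
    rw [← add_assoc]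
    omega

lemma IsGeodesic.d_add_d {v : ℕ → W} {n k : ℕ} (h : IsGeodesic cs v n) (hk : k ≤ n) :
    d cs (v 0) (v k) + d cs (v k) (v n) = d cs (v 0) (v n) := by
  have h₁ := h.1.d_le 0 k (by omega)
  have h₂ := h.1.d_le k (n - k) (by omega)
  have h₃ := d_triangle (cs := cs) (v 0) (v k) (v n)
  rw [zero_add] at h₁
  rw [Nat.add_sub_cancel' hk] at h₂
  have := h.2
  omega

end Sides

/-- If `α = v 0, …, v n` is a geodesic edge path whose endpoints are each within `A` of
`Q̄` for some wall `Q` (with reflection `t`), then every vertex of `α` is within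
`2A(2 P 1 + 1) + P 1` of `Q̄`. -/
theorem near_lemma {B : Type*} {W : Type*} [Group W] [Finite B]
    {M : CoxeterMatrix B} (cs : CoxeterSystem M W)
    (P : ℕ → ℕ) (hP : IsParallelWallFn cs P)
    (v : ℕ → W) (n : ℕ) (hgeo : IsGeodesic cs v n)
    (t : W) (ht : cs.IsReflection t) (A : ℕ)
    (ha : wallDist cs t (v 0) ≤ A) (hb : wallDist cs t (v n) ≤ A) :
    ∀ k, k ≤ n → wallDist cs t (v k) ≤ 2 * A * (2 * P 1 + 1) + P 1 := by
  intro k hk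
  have hcard := ncard_wallSeparators_le ht ha hb (hgeo.d_add_d hk)
  have hdist := wallDist_le_of_ncard_wallSeparators hP ht (v k)
  have hmul := Nat.mul_le_mul_right (2 * P 1 + 1) hcard
  omega

end CoxTrack
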